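/- Let p > 3 be prime. Every element of p-power order in Hol(M₁) has order dividing p; equivalently, every Sylow p-subgroup of Hol(M₁) (which has order p⁶) has exponent p. In particular, for every v ∈ M₁ and all integers a₁, a₂, a₃, the element v·α₁^{a₁}α₂^{a₂}α₃^{a₃} of Hol(M₁) satisfies (v·α₁^{a₁}α₂^{a₂}α₃^{a₃})^p = 1. -/

import Mathlib

/-! ## The Heisenberg group of order `p³` -/

@[ext]
structure Heisenberg (p : ℕ) where
  x : ZMod p
  y : ZMod p
  z : ZMod p

namespace Heisenberg

variable {p : ℕ}

instance : Mul (Heisenberg p) :=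
  ⟨fun g h => ⟨g.x + h.x, g.y + h.y, g.z + h.z + h.x * g.y⟩⟩

instance : One (Heisenberg p) := ⟨⟨0, 0, 0⟩⟩

instance : Inv (Heisenberg p) := ⟨fun g => ⟨-g.x, -g.y, -g.z + g.x * g.y⟩⟩

@[simp] theorem mul_x (g h : Heisenberg p) : (g * h).x = g.x + h.x := rfl
@[simp] theorem mul_y (g h : Heisenberg p) : (g * h).y = g.y + h.y := rfl
@[simp] theorem mul_z (g h : Heisenberg p) : (g * h).z = g.z + h.z + h.x * g.y := rfl
@[simp] theorem one_x : (1 : Heisenberg p).x = 0 := rfl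
@[simp] theorem one_y : (1 : Heisenberg p).y = 0 := rfl
@[simp] theorem one_z : (1 : Heisenberg p).z = 0 := rfl
@[simp] theorem inv_x (g : Heisenberg p) : (g⁻¹).x = -g.x := rfl
@[simp] theorem inv_y (g : Heisenberg p) : (g⁻¹).y = -g.y := rfl
@[simp] theorem inv_z (g : Heisenberg p) : (g⁻¹).z = -g.z + g.x * g.y := rfl

instance : Group (Heisenberg p) where
  mul_assoc a b c := by ext <;> simp <;> ring
  one_mul a := by ext <;> simp
  mul_one a := by ext <;> simp
  inv_mul_cancel a := by ext <;> simp <;> ring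

/-- The generator `ρ` (a generator of the centre). -/
def ρ : Heisenberg p := ⟨0, 0, 1⟩

/-- The generator `σ`. -/
def σ : Heisenberg p := ⟨1, 0, 0⟩

/-- The generator `τ`. -/
def τ : Heisenberg p := ⟨0, 1, 0⟩

/-- The automorphism `α₁` determined by `σ ↦ ρσ`, `τ ↦ τ` (and `ρ ↦ ρ`). -/
def α₁ : MulAut (Heisenberg p) where
  toFun g := ⟨g.x, g.y, g.z + g.x⟩
  invFun g := ⟨g.x, g.y, g.z - g.x⟩
  left_inv g := by ext <;> simp
  right_inv g := by ext <;> simp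
  map_mul' g h := by ext <;> simp <;> ring

/-- The automorphism `α₃` determined by `σ ↦ σ`, `τ ↦ ρτ` (and `ρ ↦ ρ`). -/
def α₃ : MulAut (Heisenberg p) where
  toFun g := ⟨g.x, g.y, g.z + g.y⟩
  invFun g := ⟨g.x, g.y, g.z - g.y⟩
  left_inv g := by ext <;> simp
  right_inv g := by ext <;> simp
  map_mul' g h := by ext <;> simp <;> ring

/-- The automorphism `α₂` determined by `σ ↦ στ`, `τ ↦ τ` (and `ρ ↦ ρ`), for `p` an odd
prime. -/
def α₂ (p : ℕ) [Fact p.Prime] (hp : p ≠ 2) : MulAut (Heisenberg p) where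
  toFun g := ⟨g.x, g.x + g.y, g.z + g.x * (g.x - 1) / 2⟩
  invFun g := ⟨g.x, g.y - g.x, g.z - g.x * (g.x - 1) / 2⟩
  left_inv g := by ext <;> simp <;> ring
  right_inv g := by ext <;> simp <;> ring
  map_mul' g h := by
    have h2 : (2 : ZMod p) ≠ 0 := by
      intro h
      have h' : ((2 : ℕ) : ZMod p) = 0 := by exact_mod_cast h
      rw [CharP.cast_eq_zero_iff (ZMod p) p 2] at h'
      have h1 := Nat.le_of_dvd (by norm_num) h'
      have h2 := (Fact.out : p.Prime).two_le
      omega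
    ext <;> simp
    · ring
    · field_simp
      ring

end Heisenberg

open Heisenberg

/-! ## The holomorph of `M₁` inside the permutation group -/

/-- The left regular representation `M₁ → Perm M₁`. -/
def leftMulHom (p : ℕ) : Heisenberg p →* Equiv.Perm (Heisenberg p) :=
  MulAction.toPermHom (Heisenberg p) (Heisenberg p)

/-- The holomorph of `M₁`, realized as the subgroup of `Perm M₁` generated by left
translations and automorphisms of `M₁`. -/
def Hol (p : ℕ) : Subgroup (Equiv.Perm (Heisenberg p)) :=
  (leftMulHom p).range ⊔
    (MulAut.toPerm (Heisenberg p)).range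

/-- A subgroup of `Perm X` is regular if it acts freely and transitively on `X`. -/
def IsRegularSub {X : Type*} (H : Subgroup (Equiv.Perm X)) : Prop :=
  ∀ x y : X, ∃! g : Equiv.Perm X, g ∈ H ∧ g x = y

/-- The canonical projection `Θ : Hol(M₁) → Aut(M₁)` (with kernel the left translations),
written as a function on permutations: it sends `π` to `m ↦ (π 1)⁻¹ * π m`; on elements of the
holomorph, this is exactly the automorphism component. -/
def theta (p : ℕ) (π : Equiv.Perm (Heisenberg p)) : Equiv.Perm (Heisenberg p) :=
  (Equiv.mulLeft (π 1))⁻¹ * π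

/-- The cardinality of the image `Θ(G)` of a subgroup `G` of the holomorph under the canonical
projection `Θ`. -/
noncomputable def thetaCard (p : ℕ) (G : Subgroup (Equiv.Perm (Heisenberg p))) : ℕ :=
  Nat.card (theta p '' (G : Set (Equiv.Perm (Heisenberg p))))

/-- The conjugation action of `Aut(M₁)` (viewed inside `Perm M₁`) on subgroups of `Perm M₁`. -/
def autConj (p : ℕ) (α : MulAut (Heisenberg p)) (G : Subgroup (Equiv.Perm (Heisenberg p))) :
    Subgroup (Equiv.Perm (Heisenberg p)) :=
  Subgroup.map (MulAut.conj (MulAut.toPerm (Heisenberg p) α)).toMonoidHom G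

namespace Heisenberg

variable {p : ℕ}

instance [NeZero p] : Finite (Heisenberg p) :=
  Finite.of_injective (fun g : Heisenberg p => (g.x, g.y, g.z)) fun g h hgh => by
    simp only [Prod.mk.injEq] at hgh
    exact Heisenberg.ext hgh.1 hgh.2.1 hgh.2.2

theorem pow_x (g : Heisenberg p) (n : ℕ) : (g ^ n).x = n * g.x := by
  induction n with
  | zero => simp
  | succ n ih => rw [pow_succ, mul_x, ih]; push_cast; ring

theorem pow_y (g : Heisenberg p) (n : ℕ) : (g ^ n).y = n * g.y := by
  induction n with
  | zero => simp
  | succ n ih => rw [pow_succ, mul_y, ih]; push_cast; ring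

theorem pow_z_of_x_mul_y_eq_zero {g : Heisenberg p} (hg : g.x * g.y = 0) (n : ℕ) :
    (g ^ n).z = n * g.z := by
  induction n with
  | zero => simp
  | succ n ih => rw [pow_succ, mul_z, ih, pow_y]; push_cast; linear_combination (n : ZMod p) * hg

theorem eq_pow_mul_pow_mul_pow [NeZero p] (g : Heisenberg p) :
    g = σ ^ g.x.val * τ ^ g.y.val * ρ ^ g.z.val := by
  have hσ : (σ : Heisenberg p).x * (σ : Heisenberg p).y = 0 := by simp [σ]
  have hτ : (τ : Heisenberg p).x * (τ : Heisenberg p).y = 0 := by simp [τ]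
  have hρ : (ρ : Heisenberg p).x * (ρ : Heisenberg p).y = 0 := by simp [ρ]
  ext <;> simp [pow_x, pow_y, pow_z_of_x_mul_y_eq_zero, hσ, hτ, hρ] <;> simp [σ, τ, ρ]

theorem mem_center_iff {g : Heisenberg p} :
    g ∈ Subgroup.center (Heisenberg p) ↔ g.x = 0 ∧ g.y = 0 := by
  rw [Subgroup.mem_center_iff]
  constructor
  · intro h
    have h₁ := congrArg Heisenberg.z (h τ)
    have h₂ := congrArg Heisenberg.z (h σ)
    simp only [mul_z] at h₁ h₂
    constructor
    · simpa [τ, add_comm] using h₁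
    · simpa [σ, add_comm] using h₂.symm
  · rintro ⟨hx, hy⟩ h
    ext <;> simp [hx, hy, add_comm]

theorem mulAut_apply_ρ_mem_center (φ : MulAut (Heisenberg p)) :
    φ ρ ∈ Subgroup.center (Heisenberg p) := by
  have hρ : (ρ : Heisenberg p) ∈ Subgroup.center (Heisenberg p) := by
    simp [mem_center_iff, ρ]
  rw [Subgroup.mem_center_iff] at hρ ⊢
  intro g
  obtain ⟨h, rfl⟩ := φ.surjective g
  rw [← map_mul, hρ, map_mul]

theorem mulAut_apply_x [NeZero p] (φ : MulAut (Heisenberg p)) (g : Heisenberg p) :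
    (φ g).x = g.x * (φ σ).x + g.y * (φ τ).x := by
  have hρ := (mem_center_iff.1 (mulAut_apply_ρ_mem_center φ)).1
  conv_lhs => rw [eq_pow_mul_pow_mul_pow g]
  simp [pow_x, hρ]

theorem mulAut_apply_y [NeZero p] (φ : MulAut (Heisenberg p)) (g : Heisenberg p) :
    (φ g).y = g.x * (φ σ).y + g.y * (φ τ).y := by
  have hρ := (mem_center_iff.1 (mulAut_apply_ρ_mem_center φ)).2
  conv_lhs => rw [eq_pow_mul_pow_mul_pow g]
  simp [pow_y, hρ]

theorem ρ_eq_commutator : (ρ : Heisenberg p) = τ * σ * (σ * τ)⁻¹ := by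
  ext <;> simp [ρ, σ, τ]

theorem mulAut_ext [NeZero p] {φ ψ : MulAut (Heisenberg p)} (hσ : φ σ = ψ σ) (hτ : φ τ = ψ τ) :
    φ = ψ := by
  have hρ : φ ρ = ψ ρ := by simp only [ρ_eq_commutator, map_mul, map_inv, hσ, hτ]
  ext1 g
  rw [eq_pow_mul_pow_mul_pow g]
  simp only [map_mul, map_pow, hσ, hτ, hρ]

/-- The action of the automorphism group on the quotient of the Heisenberg group by its centre,
in coordinates. -/
abbrev mulAutActionModCenter (p : ℕ) [NeZero p] :
    MulAction (MulAut (Heisenberg p)) (ZMod p × ZMod p) where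
  smul φ u := ((φ ⟨u.1, u.2, 0⟩).x, (φ ⟨u.1, u.2, 0⟩).y)
  one_smul _ := rfl
  mul_smul φ ψ u := by
    refine Prod.ext ?_ ?_
    · exact (mulAut_apply_x φ (ψ ⟨u.1, u.2, 0⟩)).trans (mulAut_apply_x φ ⟨_, _, 0⟩).symm
    · exact (mulAut_apply_y φ (ψ ⟨u.1, u.2, 0⟩)).trans (mulAut_apply_y φ ⟨_, _, 0⟩).symm

/-- A permutation of the Heisenberg group that is unipotent with respect to the coordinates
`x`, `y`, `z`; those of this form make up a Sylow `p`-subgroup of the holomorph. -/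
def unipotentPerm (a b c d e f : ZMod p) : Equiv.Perm (Heisenberg p) where
  toFun g := ⟨g.x + a, g.y + 2 * c * g.x + b, g.z + f + d * g.x + e * g.y + c * g.x ^ 2⟩
  invFun g := ⟨g.x - a, g.y - 2 * c * (g.x - a) - b,
    g.z - f - d * (g.x - a) - e * (g.y - 2 * c * (g.x - a) - b) - c * (g.x - a) ^ 2⟩
  left_inv g := by ext <;> simp <;> ring
  right_inv g := by ext <;> simp <;> ring

theorem unipotentPerm_apply (a b c d e f : ZMod p) (g : Heisenberg p) :
    unipotentPerm a b c d e f g =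
      ⟨g.x + a, g.y + 2 * c * g.x + b, g.z + f + d * g.x + e * g.y + c * g.x ^ 2⟩ := rfl

theorem unipotentPerm_pow_apply (a b c d e f : ZMod p) (n : ℕ) (g : Heisenberg p) :
    (unipotentPerm a b c d e f ^ n) g =
      ⟨g.x + n * a,
        g.y + n * (2 * c * g.x + b) + n.choose 2 * (2 * c * a),
        g.z + n * (f + d * g.x + e * g.y + c * g.x ^ 2) +
          n.choose 2 * (d * a + e * (2 * c * g.x + b) + 2 * c * a * g.x + c * a ^ 2) +
          n.choose 3 * (2 * e * c * a + 2 * c * a ^ 2)⟩ := by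
  induction n with
  | zero => ext <;> simp
  | succ n ih =>
    have hsq : (n : ZMod p) ^ 2 = 2 * n.choose 2 + n := by
      have h' : n ^ 2 = 2 * n.choose 2 + n := by
        rw [Nat.choose_two_right, Nat.mul_div_cancel' (Nat.even_mul_pred_self n).two_dvd]
        cases n <;> simp <;> ring
      exact_mod_cast congrArg (Nat.cast : ℕ → ZMod p) h'
    rw [pow_succ', Equiv.Perm.mul_apply, ih, unipotentPerm_apply]
    ext
    · simp only []; push_cast; ring
    · simp only [Nat.choose_succ_succ' n 1, Nat.choose_one_right]; push_cast; ring
    · simp only [Nat.choose_succ_succ' n 1, Nat.choose_succ_succ' n 2, Nat.choose_one_right]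
      push_cast
      linear_combination c * a ^ 2 * hsq

theorem unipotentPerm_pow_prime [Fact p.Prime] (h3 : 3 < p) (a b c d e f : ZMod p) :
    unipotentPerm a b c d e f ^ p = 1 := by
  have hp : p.Prime := Fact.out
  have h₂ : (p.choose 2 : ZMod p) = 0 :=
    (ZMod.natCast_eq_zero_iff _ _).2 (hp.dvd_choose_self two_ne_zero (Nat.lt_of_succ_lt h3))
  have h₃ : (p.choose 3 : ZMod p) = 0 :=
    (ZMod.natCast_eq_zero_iff _ _).2 (hp.dvd_choose_self three_ne_zero h3)
  ext1 g
  rw [unipotentPerm_pow_apply]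
  simp [h₂, h₃]

theorem two_ne_zero_zmod [Fact p.Prime] (hp : p ≠ 2) : (2 : ZMod p) ≠ 0 :=
  Ring.two_ne_zero (by rwa [ZMod.ringChar_zmod_n])

theorem unipotentPerm_injective [Fact p.Prime] (hp : p ≠ 2) :
    Function.Injective fun t : ZMod p × ZMod p × ZMod p × ZMod p × ZMod p × ZMod p =>
      unipotentPerm t.1 t.2.1 t.2.2.1 t.2.2.2.1 t.2.2.2.2.1 t.2.2.2.2.2 := by
  rintro ⟨a, b, c, d, e, f⟩ ⟨a', b', c', d', e', f'⟩ h
  have h1 := Equiv.congr_fun h 1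
  have hσ := Equiv.congr_fun h σ
  have hτ := Equiv.congr_fun h τ
  simp only [unipotentPerm_apply, Heisenberg.mk.injEq] at h1 hσ hτ
  simp only [one_x, one_y, one_z, σ, τ] at h1 hσ hτ
  have ha : a = a' := by linear_combination h1.1
  have hb : b = b' := by linear_combination h1.2.1
  have hf : f = f' := by linear_combination h1.2.2
  have he : e = e' := by linear_combination hτ.2.2 - h1.2.2
  have hc : c = c' := mul_left_cancel₀ (two_ne_zero_zmod hp)
    (by linear_combination hσ.2.1 - h1.2.1)
  have hd : d = d' := by linear_combination hσ.2.2 - hc - h1.2.2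
  rw [ha, hb, hc, hd, he, hf]

/-- The group of unipotent permutations of the Heisenberg group. -/
def unipotentSubgroup (p : ℕ) : Subgroup (Equiv.Perm (Heisenberg p)) where
  carrier := Set.range fun t : ZMod p × ZMod p × ZMod p × ZMod p × ZMod p × ZMod p =>
    unipotentPerm t.1 t.2.1 t.2.2.1 t.2.2.2.1 t.2.2.2.2.1 t.2.2.2.2.2
  one_mem' := ⟨0, by ext1 g; simp [unipotentPerm_apply]⟩
  mul_mem' := by
    rintro _ _ ⟨⟨a, b, c, d, e, f⟩, rfl⟩ ⟨⟨a', b', c', d', e', f'⟩, rfl⟩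
    refine ⟨⟨a + a', b + b' + 2 * c * a', c + c', d + d' + 2 * e * c' + 2 * c * a', e + e',
      f + f' + d * a' + e * b' + c * a' ^ 2⟩, ?_⟩
    ext g <;> simp [unipotentPerm_apply] <;> ring
  inv_mem' := by
    rintro _ ⟨⟨a, b, c, d, e, f⟩, rfl⟩
    refine ⟨⟨-a, 2 * c * a - b, -c, -d + 2 * e * c + 2 * c * a, -e,
      -f + d * a - e * (2 * c * a - b) - c * a ^ 2⟩, ?_⟩
    refine eq_inv_of_mul_eq_one_left ?_
    ext g <;> simp [unipotentPerm_apply] <;> ring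

theorem unipotentPerm_mem (a b c d e f : ZMod p) :
    unipotentPerm a b c d e f ∈ unipotentSubgroup p :=
  ⟨(a, b, c, d, e, f), rfl⟩

theorem exists_eq_unipotentPerm {g : Equiv.Perm (Heisenberg p)} (hg : g ∈ unipotentSubgroup p) :
    ∃ a b c d e f, g = unipotentPerm a b c d e f := by
  obtain ⟨⟨a, b, c, d, e, f⟩, rfl⟩ := hg
  exact ⟨a, b, c, d, e, f, rfl⟩

theorem card_unipotentSubgroup [Fact p.Prime] (hp : p ≠ 2) : Nat.card (unipotentSubgroup p) = p ^ 6 := by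
  refine (Nat.card_range_of_injective (unipotentPerm_injective hp)).trans ?_
  simp only [Nat.card_prod, Nat.card_zmod]
  ring

theorem leftMulHom_apply (v g : Heisenberg p) : leftMulHom p v g = v * g := rfl

theorem toPerm_apply (φ : MulAut (Heisenberg p)) (g : Heisenberg p) :
    MulAut.toPerm (Heisenberg p) φ g = φ g := rfl

theorem leftMulHom_mem_unipotentSubgroup (v : Heisenberg p) :
    leftMulHom p v ∈ unipotentSubgroup p := by
  refine ⟨⟨v.x, v.y, 0, v.y, 0, v.z⟩, ?_⟩
  ext g <;> simp [unipotentPerm_apply, leftMulHom_apply] <;> ring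

/-- The unipotent automorphism of the Heisenberg group with the given parameters. -/
def unipotentAut (c d e : ZMod p) : MulAut (Heisenberg p) where
  toEquiv := unipotentPerm 0 0 c d e 0
  map_mul' g h := by ext <;> simp [unipotentPerm_apply] <;> ring

theorem toPerm_unipotentAut (c d e : ZMod p) :
    MulAut.toPerm (Heisenberg p) (unipotentAut c d e) = unipotentPerm 0 0 c d e 0 := rfl

theorem unipotentAut_apply_σ (c d e : ZMod p) : unipotentAut c d e σ = ⟨1, 2 * c, d + c⟩ := by
  change unipotentPerm _ _ _ _ _ _ σ = _
  simp [unipotentPerm_apply, σ]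

theorem unipotentAut_apply_τ (c d e : ZMod p) : unipotentAut c d e τ = ⟨0, 1, e⟩ := by
  change unipotentPerm _ _ _ _ _ _ τ = _
  simp [unipotentPerm_apply, τ]

theorem α₁_eq_unipotentAut : (α₁ : MulAut (Heisenberg p)) = unipotentAut 0 1 0 := by
  ext1 g
  change (⟨_, _, _⟩ : Heisenberg p) = unipotentPerm _ _ _ _ _ _ g
  ext <;> simp [unipotentPerm_apply]

theorem α₃_eq_unipotentAut : (α₃ : MulAut (Heisenberg p)) = unipotentAut 0 0 1 := by
  ext1 g
  change (⟨_, _, _⟩ : Heisenberg p) = unipotentPerm _ _ _ _ _ _ g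
  ext <;> simp [unipotentPerm_apply]

theorem α₂_eq_unipotentAut [Fact p.Prime] (hp : p ≠ 2) :
    α₂ p hp = unipotentAut 2⁻¹ (-2⁻¹) 0 := by
  have h2 := two_ne_zero_zmod hp
  ext1 g
  change (⟨_, _, _⟩ : Heisenberg p) = unipotentPerm _ _ _ _ _ _ g
  ext
  · simp [unipotentPerm_apply]
  · simp [unipotentPerm_apply, h2, add_comm]
  · simp only [unipotentPerm_apply]; ring

theorem unipotentSubgroup_le_Hol : unipotentSubgroup p ≤ Hol p := by
  rintro _ ⟨⟨a, b, c, d, e, f⟩, rfl⟩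
  have h : unipotentPerm a b c d e f =
      leftMulHom p ⟨a, b, f⟩ * MulAut.toPerm (Heisenberg p) (unipotentAut c (d - b) e) := by
    rw [toPerm_unipotentAut]
    ext g <;> simp [unipotentPerm_apply, leftMulHom_apply] <;> ring
  simp only [h]
  exact mul_mem (Subgroup.mem_sup_left ⟨_, rfl⟩) (Subgroup.mem_sup_right ⟨_, rfl⟩)

theorem exists_eq_leftMulHom_mul_toPerm {g : Equiv.Perm (Heisenberg p)} (hg : g ∈ Hol p) :
    ∃ v φ, g = leftMulHom p v * MulAut.toPerm (Heisenberg p) φ := by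
  rw [Hol, Subgroup.sup_eq_closure] at hg
  induction hg using Subgroup.closure_induction with
  | mem g hg =>
    rcases hg with ⟨v, rfl⟩ | ⟨φ, rfl⟩
    · exact ⟨v, 1, by simp⟩
    · exact ⟨1, φ, by simp⟩
  | one => exact ⟨1, 1, by simp⟩
  | mul g h _ _ ihg ihh =>
    obtain ⟨v, φ, rfl⟩ := ihg
    obtain ⟨w, ψ, rfl⟩ := ihh
    refine ⟨v * φ w, φ * ψ, ?_⟩
    ext1 m
    simp [leftMulHom_apply, toPerm_apply, mul_assoc]
  | inv g _ ih =>
    obtain ⟨v, φ, rfl⟩ := ih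
    refine ⟨φ⁻¹ v⁻¹, φ⁻¹, inv_eq_of_mul_eq_one_right (Equiv.ext fun m => ?_)⟩
    change v * φ (φ⁻¹ v⁻¹ * φ⁻¹ m) = m
    simp only [map_mul, MulAut.apply_inv_self, mul_inv_cancel_left]

theorem mulAut_pow_apply_σ_x [NeZero p] {φ : MulAut (Heisenberg p)} (hτ : (φ τ).x = 0) (n : ℕ) :
    ((φ ^ n) σ).x = (φ σ).x ^ n := by
  induction n with
  | zero => simp [σ]
  | succ n ih => rw [pow_succ', MulAut.mul_apply, mulAut_apply_x, ih, hτ]; ring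

theorem eq_unipotentAut [Fact p.Prime] (hp : p ≠ 2) {φ : MulAut (Heisenberg p)}
    (hσ : (φ σ).x = 1) (hτx : (φ τ).x = 0) (hτy : (φ τ).y = 1) :
    φ = unipotentAut ((φ σ).y / 2) ((φ σ).z - (φ σ).y / 2) (φ τ).z := by
  have h2 := two_ne_zero_zmod hp
  apply mulAut_ext
  · rw [unipotentAut_apply_σ]
    ext
    · exact hσ
    · simp only []; field_simp
    · simp
  · rw [unipotentAut_apply_τ]
    exact Heisenberg.ext hτx hτy rfl

/-- A `p`-group of automorphisms containing the unipotent ones consists of unipotent ones. -/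
theorem exists_eq_unipotentAut_of_isPGroup [Fact p.Prime] (hp : p ≠ 2)
    {Q : Subgroup (MulAut (Heisenberg p))} (hQ : IsPGroup p Q)
    (hle : ∀ c d e, unipotentAut c d e ∈ Q) {φ : MulAut (Heisenberg p)} (hφ : φ ∈ Q) :
    ∃ c d e, φ = unipotentAut c d e := by
  let _ := mulAutActionModCenter p
  have hzero : (0 : ZMod p × ZMod p) ∈ MulAction.fixedPoints Q (ZMod p × ZMod p) := by
    rintro ⟨ψ, -⟩
    change ((ψ ⟨0, 0, 0⟩).x, (ψ ⟨0, 0, 0⟩).y) = _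
    rw [mulAut_apply_x, mulAut_apply_y]
    simp
  obtain ⟨⟨u, w⟩, hfix, hne⟩ := hQ.exists_fixed_point_of_prime_dvd_card_of_fixed_point
    (ZMod p × ZMod p) (by simp) hzero
  have happly (ψ : MulAut (Heisenberg p)) (hψ : ψ ∈ Q) :
      (ψ ⟨u, w, 0⟩).x = u ∧ (ψ ⟨u, w, 0⟩).y = w :=
    Prod.ext_iff.1 (hfix ⟨ψ, hψ⟩)
  obtain rfl : u = 0 := by
    have h : (unipotentPerm 0 0 2⁻¹ 0 0 0 ⟨u, w, 0⟩).y = w := (happly _ (hle 2⁻¹ 0 0)).2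
    simpa [unipotentPerm_apply, two_ne_zero_zmod hp] using h
  have hw : w ≠ 0 := by rintro rfl; exact hne rfl
  obtain ⟨hx, hy⟩ := happly φ hφ
  rw [mulAut_apply_x] at hx
  rw [mulAut_apply_y] at hy
  have hτx : (φ τ).x = 0 := by simpa [hw] using hx
  have hτy : (φ τ).y = 1 := by simpa [hw] using hy
  obtain ⟨k, hk⟩ := hQ ⟨φ, hφ⟩
  have hσ : (φ σ).x = 1 := by
    have h := mulAut_pow_apply_σ_x hτx (p ^ k)
    rw [ZMod.pow_card_pow, show φ ^ p ^ k = 1 from congrArg Subtype.val hk] at h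
    exact h.symm
  exact ⟨_, _, _, eq_unipotentAut hp hσ hτx hτy⟩

theorem pow_prime_of_mem_unipotentSubgroup [Fact p.Prime] (h3 : 3 < p)
    {g : Equiv.Perm (Heisenberg p)} (hg : g ∈ unipotentSubgroup p) : g ^ p = 1 := by
  obtain ⟨a, b, c, d, e, f, rfl⟩ := exists_eq_unipotentPerm hg
  exact unipotentPerm_pow_prime h3 a b c d e f

theorem toPerm_injective : Function.Injective (MulAut.toPerm (Heisenberg p)) := fun _ _ h =>
  MulEquiv.ext fun g => Equiv.congr_fun h g

theorem mem_unipotentSubgroup_of_isPGroup [Fact p.Prime] (hp : p ≠ 2)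
    {Q : Subgroup (Equiv.Perm (Heisenberg p))} (hQ : IsPGroup p Q)
    (hle : unipotentSubgroup p ≤ Q) {g : Equiv.Perm (Heisenberg p)} (hg : g ∈ Q)
    (hHol : g ∈ Hol p) : g ∈ unipotentSubgroup p := by
  obtain ⟨v, φ, rfl⟩ := exists_eq_leftMulHom_mul_toPerm hHol
  have hv := leftMulHom_mem_unipotentSubgroup v
  have hφ : φ ∈ Q.comap (MulAut.toPerm (Heisenberg p)) :=
    (Subgroup.mul_mem_cancel_left Q (hle hv)).1 hg
  obtain ⟨c, d, e, rfl⟩ := exists_eq_unipotentAut_of_isPGroup hp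
    (hQ.comap_of_injective _ toPerm_injective)
    (fun c d e => hle (unipotentPerm_mem 0 0 c d e 0)) hφ
  exact mul_mem hv (unipotentPerm_mem 0 0 c d e 0)

/-- The unipotent permutations form a Sylow `p`-subgroup of the holomorph. -/
def unipotentSylow [Fact p.Prime] (h3 : 3 < p) : Sylow p (Hol p) where
  toSubgroup := (unipotentSubgroup p).subgroupOf (Hol p)
  isPGroup' := fun ⟨_, hg⟩ => ⟨1, Subtype.ext <| Subtype.ext <| by
    simpa using pow_prime_of_mem_unipotentSubgroup h3 hg⟩
  is_maximal' {Q} hQ hle := by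
    refine le_antisymm (fun g hg => ?_) hle
    refine mem_unipotentSubgroup_of_isPGroup (Nat.lt_of_succ_lt h3).ne' (hQ.map (Hol p).subtype) ?_
      (Subgroup.mem_map_of_mem _ hg) g.2
    intro h hh
    exact ⟨⟨h, unipotentSubgroup_le_Hol hh⟩, hle hh, rfl⟩

theorem card_unipotentSylow [Fact p.Prime] (h3 : 3 < p) :
    Nat.card (unipotentSylow h3) = p ^ 6 :=
  (Nat.card_congr (Subgroup.subgroupOfEquivOfLe unipotentSubgroup_le_Hol).toEquiv).trans
    (card_unipotentSubgroup (Nat.lt_of_succ_lt h3).ne')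

theorem pow_prime_of_mem_unipotentSylow [Fact p.Prime] (h3 : 3 < p) (g : unipotentSylow h3) :
    g ^ p = 1 :=
  Subtype.ext <| Subtype.ext <| pow_prime_of_mem_unipotentSubgroup h3 g.2

end Heisenberg

theorem card_sylow_Hol {p : ℕ} [Fact p.Prime] (h3 : 3 < p) (P : Sylow p (Hol p)) :
    Nat.card P = p ^ 6 :=
  (Nat.card_congr (P.equiv (unipotentSylow h3)).toEquiv).trans (card_unipotentSylow h3)

theorem pow_prime_of_sylow_Hol {p : ℕ} [Fact p.Prime] (h3 : 3 < p) (P : Sylow p (Hol p))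
    (g : P) : g ^ p = 1 := by
  apply (P.equiv (unipotentSylow h3)).injective
  rw [map_pow, map_one, pow_prime_of_mem_unipotentSylow]

theorem exponent_sylow_Hol {p : ℕ} [Fact p.Prime] (h3 : 3 < p) (P : Sylow p (Hol p)) :
    Monoid.exponent P = p := by
  have hp : p.Prime := Fact.out
  refine (hp.eq_one_or_self_of_dvd _
    (Monoid.exponent_dvd_of_forall_pow_eq_one (pow_prime_of_sylow_Hol h3 P))).resolve_left ?_
  intro h
  have := Monoid.exp_eq_one_iff.1 h
  have hcard : Nat.card P = p ^ 6 := card_sylow_Hol h3 P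
  have hone : Nat.card P = 1 := Nat.card_of_subsingleton 1
  exact (Nat.one_lt_pow (by norm_num) hp.one_lt).ne (hone.symm.trans hcard)

/-- Every element of `p`-power order in `Hol(M₁)` has order dividing `p`;
equivalently every Sylow `p`-subgroup of `Hol(M₁)` (which has order `p⁶`) has exponent `p`. In
particular `(v·α₁^{a₁}α₂^{a₂}α₃^{a₃})^p = 1` for every `v ∈ M₁` and all integers `aᵢ`. -/
theorem hol_M1_p_power_elements (p : ℕ) [Fact p.Prime] (h3 : 3 < p) :
    (∀ g : Equiv.Perm (Heisenberg p), g ∈ Hol p → (∃ k : ℕ, orderOf g = p ^ k) →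
      orderOf g ∣ p) ∧
    (∀ P : Sylow p (Hol p),
      Nat.card (P : Subgroup (Hol p)) = p ^ 6 ∧
      Monoid.exponent (P : Subgroup (Hol p)) = p) ∧
    (∀ (v : Heisenberg p) (a₁ a₂ a₃ : ℤ),
      (leftMulHom p v * MulAut.toPerm (Heisenberg p) α₁ ^ a₁ *
        MulAut.toPerm (Heisenberg p) (α₂ p (by omega)) ^ a₂ *
        MulAut.toPerm (Heisenberg p) α₃ ^ a₃) ^ p = 1) := by
  refine ⟨fun g hg ⟨k, hk⟩ => ?_, fun P => ⟨card_sylow_Hol h3 P, exponent_sylow_Hol h3 P⟩,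
    fun v a₁ a₂ a₃ => ?_⟩
  · have hpg : IsPGroup p (Subgroup.zpowers (⟨g, hg⟩ : Hol p)) := by
      refine IsPGroup.of_card (n := k) ?_
      rw [Nat.card_zpowers, Subgroup.orderOf_mk, hk]
    obtain ⟨P, hP⟩ := hpg.exists_le_sylow
    have h := pow_prime_of_sylow_Hol h3 P ⟨_, hP (Subgroup.mem_zpowers _)⟩
    exact orderOf_dvd_of_pow_eq_one
      (congrArg Subtype.val (congrArg Subtype.val h))
  · have hmem (c d e : ZMod p) :
        MulAut.toPerm (Heisenberg p) (unipotentAut c d e) ∈ unipotentSubgroup p :=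
      unipotentPerm_mem 0 0 c d e 0
    apply pow_prime_of_mem_unipotentSubgroup h3
    rw [α₁_eq_unipotentAut, α₂_eq_unipotentAut, α₃_eq_unipotentAut]
    exact mul_mem (mul_mem (mul_mem (leftMulHom_mem_unipotentSubgroup v)
      (zpow_mem (hmem _ _ _) _)) (zpow_mem (hmem _ _ _) _)) (zpow_mem (hmem _ _ _) _)
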